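/- Let S be a string, k a positive integer, and P, P' patterns with P a prefix of P'. Suppose (i, j) is a consecutive occurrence of P in S that is among the k closest consecutive occurrences of P, in the sense that card{(a, b) ∈ D_S(P) : b − a < j − i} < k. If both i and j are occurrences of P' in S, then (i, j) is a consecutive occurrence of P' in S and is again among the k closest, i.e., card{(a, b) ∈ D_S(P') : b − a < j − i} < k. -/

import Mathlib

variable {α : Type*}

/-- `i` is an occurrence of pattern `P` in string `S`. -/
def IsOcc (S P : List α) (i : ℕ) : Prop :=
  i + P.length ≤ S.length ∧ ∀ t < P.length, S[i + t]? = P[t]?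

/-- The set of occurrences of `P` in `S`. -/
def OccSet (S P : List α) : Set ℕ := {i | IsOcc S P i}

/-- `(i, j)` is a consecutive occurrence of `P` in `S`. -/
def IsConsec (S P : List α) (i j : ℕ) : Prop :=
  i < j ∧ IsOcc S P i ∧ IsOcc S P j ∧ ∀ k, i < k → k < j → ¬ IsOcc S P k

/-- The set of consecutive occurrences of `P` in `S`. -/
def DSet (S P : List α) : Set (ℕ × ℕ) := {p | IsConsec S P p.1 p.2}

/-- If `(i,j)` is among the `k` closest consecutive occurrences of `P` and both `i` and `j`
are occurrences of the extension `P'`, then `(i,j)` is a consecutive occurrence of `P'` and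
is again among the `k` closest. -/
theorem stmt_7 (S P P' : List α) (hpre : P <+: P') (k : ℕ) (hk : 0 < k) (i j : ℕ)
    (h : IsConsec S P i j)
    (htop : {p ∈ DSet S P | p.2 - p.1 < j - i}.ncard < k)
    (hi : IsOcc S P' i) (hj : IsOcc S P' j) :
    IsConsec S P' i j ∧ {p ∈ DSet S P' | p.2 - p.1 < j - i}.ncard < k := by
  classical
  have mono : ∀ x, IsOcc S P' x → IsOcc S P x := by
    rintro x ⟨h1, h2⟩
    obtain ⟨Q, rfl⟩ := hpre
    rw [List.length_append] at h1 h2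
    refine ⟨by omega, fun t ht => ?_⟩
    rw [h2 t (by omega), List.getElem?_append_left ht]
  refine ⟨⟨h.1, hi, hj, fun m h1 h2 h3 => h.2.2.2 m h1 h2 (mono m h3)⟩, lt_of_le_of_lt ?_ htop⟩
  have ex : ∀ p ∈ DSet S P', ∃ c, IsConsec S P p.1 c ∧ c ≤ p.2 := by
    rintro ⟨a, b⟩ ⟨hab, ha, hb, -⟩
    have hex : ∃ c, a < c ∧ IsOcc S P c := ⟨b, hab, mono b hb⟩
    refine ⟨Nat.find hex, ⟨(Nat.find_spec hex).1, mono a ha, (Nat.find_spec hex).2, ?_⟩,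
      Nat.find_min' hex ⟨hab, mono b hb⟩⟩
    intro m h1 h2 h3
    exact Nat.find_min hex h2 ⟨h1, h3⟩
  choose! f hf using ex
  refine Set.ncard_le_ncard_of_injOn (fun p => (p.1, f p)) ?_ ?_ ?_
  · rintro p ⟨hp, hd⟩
    obtain ⟨h1, h2⟩ := hf p hp
    refine ⟨h1, ?_⟩
    show f p - p.1 < j - i
    omega
  · rintro ⟨a, b⟩ ⟨⟨hab, -, hb, hn⟩, -⟩ ⟨a', b'⟩ ⟨⟨hab', -, hb', hn'⟩, -⟩ heq
    have hA : a = a' := congrArg Prod.fst heq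
    subst hA
    have hB : b = b' := by
      rcases lt_trichotomy b b' with hlt | he | hlt
      · exact absurd hb (hn' b hab hlt)
      · exact he
      · exact absurd hb' (hn b' hab' hlt)
    rw [hB]
  · refine ((Set.finite_Iic S.length).prod (Set.finite_Iic S.length)).subset ?_
    rintro ⟨a, b⟩ ⟨⟨-, ha, hb, -⟩, -⟩
    exact ⟨le_trans (Nat.le_add_right _ _) ha.1, le_trans (Nat.le_add_right _ _) hb.1⟩
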